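/- Let $f : [0,1] \to \mathbb{R}$ be infinitely differentiable and suppose there are constants $M > 0$ and $\rho > 0$ such that $|f^{(k)}(x)| \le M\, k!\, (2\rho)^{-k}$ for all integers $k \ge 0$ and all $x \in [0,1]$. Let $E \subset [0,1]$ be a Lebesgue measurable set with $|E| > 0$. Then there exist constants $N > 0$ and $\gamma \in (0,1)$, depending only on $\rho$ and $|E|$, such that $\|f\|_{L^\infty([0,1])} \le N\, \|f\|_{L^\infty(E)}^{\gamma} M^{1-\gamma}$. -/

import Mathlib

open MeasureTheory Set

/-- A set of measure at least `2hn` contains `n` increasing points with gaps at least `h`. -/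
theorem exists_separated_seq {h : ℝ} (hh : 0 < h) (n : ℕ) :
    ∀ E : Set ℝ, BddBelow E → ENNReal.ofReal (2 * h * n) ≤ volume E →
      ∃ x : ℕ → ℝ, (∀ i < n, x i ∈ E) ∧ ∀ i j, i ≤ j → j < n → ((j : ℝ) - i) * h ≤ x j - x i := by
  induction n with
  | zero => exact fun E _ _ => ⟨fun _ => 0, by simp, by simp⟩
  | succ n ih =>
    intro E hE hvol
    have hne : E.Nonempty := by
      by_contra hcon
      rw [not_nonempty_iff_eq_empty] at hcon
      rw [hcon, measure_empty, nonpos_iff_eq_zero, ENNReal.ofReal_eq_zero] at hvol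
      push_cast at hvol
      have : 0 < 2 * h * ((n : ℝ) + 1) := by positivity
      linarith
    obtain ⟨y, hyE, hy⟩ := exists_lt_of_csInf_lt hne (lt_add_of_pos_right (sInf E) hh)
    have hcover : E ⊆ (E ∩ Ici (y + h)) ∪ Icc (sInf E) (sInf E + 2 * h) := by
      intro z hz
      rcases le_or_gt (y + h) z with hzy | hzy
      · exact Or.inl ⟨hz, hzy⟩
      · exact Or.inr ⟨csInf_le hE hz, by linarith⟩
    have hvol' : ENNReal.ofReal (2 * h * n) ≤ volume (E ∩ Ici (y + h)) := by
      have h1 := hvol.trans ((measure_mono hcover).trans (measure_union_le _ _))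
      rw [Real.volume_Icc, show sInf E + 2 * h - sInf E = 2 * h by ring,
        show 2 * h * ((n + 1 : ℕ) : ℝ) = 2 * h * n + 2 * h by push_cast; ring,
        ENNReal.ofReal_add (by positivity) (by positivity)] at h1
      exact (ENNReal.add_le_add_iff_right ENNReal.ofReal_ne_top).1 h1
    obtain ⟨x, hxE, hx⟩ := ih _ (hE.mono inter_subset_left) hvol'
    refine ⟨fun i => Nat.casesOn i y x, ?_, ?_⟩
    · rintro (_ | i) hi
      · exact hyE
      · exact (hxE i (by lia)).1
    · rintro (_ | i) (_ | j) hij hj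
      · simp
      · have h1 : y + h ≤ x 0 := (hxE 0 (by lia)).2
        have h2 := hx 0 j (by lia) (by lia)
        push_cast at h2 ⊢
        change _ ≤ x j - y
        linarith
      · lia
      · have h2 := hx i j (by lia) (by lia)
        push_cast at h2 ⊢
        linarith

theorem prod_erase_abs_sub (i k : ℕ) :
    ∏ j ∈ (Finset.range (i + k + 1)).erase i, |(i : ℝ) - j| = i.factorial * k.factorial := by
  have h1 : ∏ j ∈ Finset.range i, |(i : ℝ) - j| = i.factorial := by
    rw [← Finset.prod_range_reflect, ← Finset.prod_range_add_one_eq_factorial]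
    push_cast
    refine Finset.prod_congr rfl fun j hj => ?_
    have : j + 1 ≤ i := Finset.mem_range.1 hj
    rw [Nat.sub_sub, add_comm 1 j, Nat.cast_sub this]
    push_cast
    rw [abs_of_nonneg] <;> ring_nf
    positivity
  have h2 : (Finset.range (i + k + 1)).erase i
      = Finset.range i ∪ (Finset.range k).image (fun j => i + 1 + j) := by
    ext j
    simp only [Finset.mem_erase, Finset.mem_range, Finset.mem_union, Finset.mem_image]
    constructor
    · intro h
      rcases lt_or_gt_of_ne h.1 with h' | h'
      · exact Or.inl h'
      · exact Or.inr ⟨j - (i + 1), by lia, by lia⟩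
    · rintro (h | ⟨a, ha, rfl⟩) <;> lia
  rw [h2, Finset.prod_union, h1, Finset.prod_image (by intro a _ b _ hab; simpa using hab),
    ← Finset.prod_range_add_one_eq_factorial k]
  · push_cast
    congr 1
    refine Finset.prod_congr rfl fun j _ => ?_
    rw [abs_sub_comm, abs_of_nonneg] <;> ring_nf
    positivity
  · rw [Finset.disjoint_left]
    intro a ha hb
    simp only [Finset.mem_range, Finset.mem_image] at ha hb
    lia

/-- Lagrange interpolation bound for a polynomial of degree at most `n` that is controlled at
`n + 1` points with gaps at least `h`. -/
theorem abs_eval_le_of_separated {n : ℕ} {P : Polynomial ℝ} (hP : P.degree < (n + 1 : ℕ))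
    {x : ℕ → ℝ} {h l q t : ℝ} (hh : 0 < h) (hl : 0 ≤ l) (hq : 0 ≤ q)
    (hx : ∀ i j, i ≤ j → j < n + 1 → ((j : ℝ) - i) * h ≤ x j - x i)
    (hxq : ∀ i < n + 1, |P.eval (x i)| ≤ q) (ht : ∀ i < n + 1, |t - x i| ≤ l) :
    |P.eval t| ≤ q * ((2 * l / h) ^ n / n.factorial) := by
  have habs : ∀ i < n + 1, ∀ j < n + 1, |(i : ℝ) - j| * h ≤ |x i - x j| := by
    intro i hi j hj
    rcases le_total i j with hij | hij
    · have := hx i j hij hj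
      have h' : (i : ℝ) ≤ j := by exact_mod_cast hij
      rw [abs_sub_comm, abs_sub_comm (x i), abs_of_nonneg (sub_nonneg.2 h')]
      exact this.trans (le_abs_self _)
    · have := hx j i hij hi
      have h' : (j : ℝ) ≤ i := by exact_mod_cast hij
      rw [abs_of_nonneg (sub_nonneg.2 h')]
      exact this.trans (le_abs_self _)
  have hinj : Set.InjOn x (Finset.range (n + 1)) := by
    intro i hi j hj hij
    have := habs i (by simpa using hi) j (by simpa using hj)
    rw [hij, sub_self, abs_zero] at this
    have h0 : |(i : ℝ) - j| ≤ 0 := by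
      by_contra hcon
      have := mul_pos (not_le.1 hcon) hh
      linarith
    have := sub_eq_zero.1 (abs_nonpos_iff.1 h0)
    exact_mod_cast this
  have hbasis : ∀ i ∈ Finset.range (n + 1),
      |(Lagrange.basis (Finset.range (n + 1)) x i).eval t|
        ≤ (l / h) ^ n / n.factorial * n.choose i := by
    intro i hi
    have hi' : i < n + 1 := Finset.mem_range.1 hi
    obtain ⟨k, rfl⟩ : ∃ k, n = i + k := ⟨n - i, by lia⟩
    have hfac : ((i + k).choose i : ℝ) / (i + k).factorial
        = ((i.factorial : ℝ) * k.factorial)⁻¹ := by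
      have hc := Nat.add_choose_mul_factorial_mul_factorial i k
      have hc' : ((i + k).choose k : ℝ) * i.factorial * k.factorial = (i + k).factorial := by
        exact_mod_cast hc
      rw [Nat.choose_symm_add, ← hc']
      have h0 : ((i + k).choose k : ℝ) ≠ 0 := by
        exact_mod_cast (Nat.choose_pos (Nat.le_add_left k i)).ne'
      field_simp
    calc |(Lagrange.basis (Finset.range (i + k + 1)) x i).eval t|
        = ∏ j ∈ (Finset.range (i + k + 1)).erase i, |t - x j| / |x i - x j| := by
          rw [Lagrange.basis, Polynomial.eval_prod, Finset.abs_prod]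
          refine Finset.prod_congr rfl fun j _ => ?_
          simp [Lagrange.basisDivisor, abs_mul, abs_inv, div_eq_inv_mul]
      _ ≤ ∏ j ∈ (Finset.range (i + k + 1)).erase i, (l / h) / |(i : ℝ) - j| := by
          refine Finset.prod_le_prod (fun _ _ => by positivity) fun j hj => ?_
          have hj' := Finset.mem_erase.1 hj
          have hj'' := Finset.mem_range.1 hj'.2
          have hpos : 0 < |(i : ℝ) - j| := by
            rw [abs_pos, sub_ne_zero]
            exact_mod_cast hj'.1.symm
          rw [div_div, mul_comm h]
          exact div_le_div₀ hl (ht j hj'') (by positivity) (habs i hi' j hj'')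
      _ = (l / h) ^ (i + k) / (i + k).factorial * (i + k).choose i := by
          rw [Finset.prod_div_distrib, prod_erase_abs_sub, Finset.prod_const,
            Finset.card_erase_of_mem hi, Finset.card_range, Nat.add_sub_cancel,
            div_mul_eq_mul_div, mul_div_assoc, hfac, div_eq_mul_inv]
  have hsum : ∑ i ∈ Finset.range (n + 1), (n.choose i : ℝ) = 2 ^ n := by
    exact_mod_cast Nat.sum_range_choose n
  rw [Lagrange.eq_interpolate (f := P) hinj (by simpa using hP), Lagrange.interpolate_apply,
    Polynomial.eval_finsetSum]
  calc _ ≤ ∑ i ∈ Finset.range (n + 1), q * ((l / h) ^ n / n.factorial * n.choose i) := by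
        refine (Finset.abs_sum_le_sum_abs _ _).trans (Finset.sum_le_sum fun i hi => ?_)
        rw [Polynomial.eval_mul, Polynomial.eval_C, abs_mul]
        exact mul_le_mul (hxq i (Finset.mem_range.1 hi)) (hbasis i hi) (abs_nonneg _) hq
    _ = q * ((2 * l / h) ^ n / n.factorial) := by
        rw [← Finset.mul_sum, ← Finset.mul_sum, hsum, mul_div_assoc 2 l h, mul_pow]
        ring

theorem exists_le_rpow_of_forall_le_mul_pow_add {A : ℝ} (hA : 2 ≤ A) :
    ∃ γ ∈ Ioo (0 : ℝ) 1, ∀ u ∈ Icc (0 : ℝ) 1, ∀ y : ℝ,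
      (∀ n : ℕ, y ≤ u * A ^ n + (1 / 2) ^ n) → y ≤ 3 * u ^ γ := by
  have hA0 : 0 < A := by linarith
  have hA1 : 1 < A := by linarith
  have hlogA : 0 < Real.log A := Real.log_pos hA1
  set γ := Real.log 2 / (2 * Real.log A) with hγ
  have hl2 : 0 < Real.log 2 := Real.log_pos (by norm_num)
  have hγ0 : 0 < γ := by positivity
  have hγ1 : γ ≤ 1 / 2 := by
    rw [hγ, div_le_div_iff₀ (by positivity) (by norm_num)]
    have := Real.log_le_log (by norm_num) hA
    linarith
  have hAγ : (A ^ 2) ^ γ = 2 := by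
    rw [Real.rpow_def_of_pos (by positivity), Real.log_pow, hγ]
    have : ((2 : ℕ) : ℝ) * Real.log A * (Real.log 2 / (2 * Real.log A)) = Real.log 2 := by
      push_cast; field_simp
    rw [this, Real.exp_log (by norm_num)]
  refine ⟨γ, ⟨hγ0, by linarith⟩, fun u hu y hy => ?_⟩
  rcases hu.1.eq_or_lt with rfl | hu0
  · rw [Real.zero_rpow hγ0.ne', mul_zero]
    refine ge_of_tendsto' (tendsto_pow_atTop_nhds_zero_of_lt_one (r := (1 / 2 : ℝ)) (by norm_num)
      (by norm_num)) fun n => ?_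
    simpa using hy n
  obtain ⟨n, hn1, hn2⟩ := exists_nat_pow_near (one_le_inv_iff₀.2 ⟨hu0, hu.2⟩)
    (show 1 < A ^ 2 by nlinarith)
  have h1 : u * A ^ n ≤ u ^ γ := by
    have h2 : u * A ^ n ≤ u ^ (1 / 2 : ℝ) := by
      rw [← Real.sqrt_eq_rpow]
      refine Real.le_sqrt_of_sq_le ?_
      rw [mul_pow, ← pow_mul, mul_comm n 2, pow_mul]
      calc u ^ 2 * (A ^ 2) ^ n ≤ u ^ 2 * u⁻¹ := by gcongr
        _ = u := by field_simp
    exact h2.trans (Real.rpow_le_rpow_of_exponent_ge hu0 hu.2 hγ1)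
  have h3 : (1 / 2 : ℝ) ^ n ≤ 2 * u ^ γ := by
    have h4 : (u⁻¹) ^ γ ≤ 2 ^ (n + 1) := by
      calc (u⁻¹) ^ γ ≤ ((A ^ 2) ^ (n + 1)) ^ γ :=
            Real.rpow_le_rpow (by positivity) hn2.le hγ0.le
        _ = 2 ^ (n + 1) := by
            rw [← Real.rpow_natCast, ← Real.rpow_mul (by positivity), mul_comm,
              Real.rpow_mul (by positivity), hAγ, Real.rpow_natCast]
    rw [Real.inv_rpow hu.1, inv_le_comm₀ (by positivity) (by positivity)] at h4
    calc (1 / 2 : ℝ) ^ n = 2 * (2 ^ (n + 1))⁻¹ := by rw [pow_succ, one_div, inv_pow]; field_simp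
      _ ≤ _ := by gcongr
  linarith [hy n]

theorem iteratedDerivWithin_subset {f : ℝ → ℝ} {s t : Set ℝ} {x : ℝ} {k : ℕ} (hst : s ⊆ t)
    (hs : UniqueDiffOn ℝ s) (ht : UniqueDiffOn ℝ t) (hf : ContDiffOn ℝ k f t) (hx : x ∈ s) :
    iteratedDerivWithin k f s x = iteratedDerivWithin k f t x := by
  rw [iteratedDerivWithin, iteratedDerivWithin, iteratedFDerivWithin_subset hst hs ht hf hx]

theorem abs_sub_taylorWithinEval_le {f : ℝ → ℝ} {a b ρ M A : ℝ} (hab : a < b) (hρ : 0 < ρ)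
    (hM : 0 < M) (hA : 1 ≤ A) (hlen : 2 * A * (b - a) ≤ ρ)
    (hf : ContDiffOn ℝ (⊤ : ℕ∞) f (Icc a b))
    (hbound : ∀ k : ℕ, ∀ x ∈ Icc a b,
      |iteratedDerivWithin k f (Icc a b) x| ≤ M * k.factorial / (2 * ρ) ^ k)
    (n : ℕ) {x : ℝ} (hx : x ∈ Icc a b) :
    |f x - taylorWithinEval f n (Icc a b) a x| ≤ M * (1 / (2 * A)) ^ n := by
  have hA0 : 0 < A := by linarith
  have hba : 0 < b - a := sub_pos.2 hab
  have h1 := taylor_mean_remainder_bound (n := n) hab.le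
    (hf.of_le (by exact_mod_cast le_top)) hx (fun y hy => hbound (n + 1) y hy)
  have hx0 : 0 ≤ x - a := sub_nonneg.2 hx.1
  have hxl : x - a ≤ b - a := by linarith [hx.2]
  have hn : ((n : ℝ) + 1) ≤ 2 ^ (n + 1) := by
    exact_mod_cast (Nat.lt_two_pow_self (n := n + 1)).le
  have hratio : (b - a) / ρ ≤ 1 / (2 * A) := by
    rw [div_le_div_iff₀ hρ (by positivity)]
    linarith
  rw [Real.norm_eq_abs] at h1
  calc |f x - taylorWithinEval f n (Icc a b) a x|
      ≤ M * (n + 1).factorial / (2 * ρ) ^ (n + 1) * (x - a) ^ (n + 1) / n.factorial := h1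
    _ = M * ((n + 1) * ((x - a) / (2 * ρ)) ^ (n + 1)) := by
        rw [Nat.factorial_succ, div_pow]
        push_cast
        field_simp
    _ ≤ M * (2 ^ (n + 1) * ((b - a) / (2 * ρ)) ^ (n + 1)) := by gcongr
    _ = M * ((b - a) / ρ) ^ (n + 1) := by
        rw [← mul_pow]
        congr 2
        field_simp
    _ ≤ M * (1 / (2 * A)) ^ (n + 1) := by gcongr
    _ ≤ M * (1 / (2 * A)) ^ n := by
        refine mul_le_mul_of_nonneg_left ?_ hM.le
        refine pow_le_pow_of_le_one (by positivity) ?_ n.le_succ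
        rw [div_le_one (by positivity)]
        linarith

theorem add_one_pow_div_factorial_le (n : ℕ) :
    ((n : ℝ) + 1) ^ n / n.factorial ≤ 3 * 3 ^ n := by
  have h1 := Real.pow_div_factorial_le_exp (x := (n : ℝ) + 1) (by positivity) n
  refine h1.trans ?_
  have h2 : Real.exp ((n : ℝ) + 1) = Real.exp 1 ^ (n + 1) := by
    rw [← Real.exp_nat_mul]
    push_cast
    rw [mul_one]
  rw [h2, ← pow_succ']
  have := Real.exp_one_lt_d9
  gcongr
  linarith

/-- Remez-type estimate on a short interval, obtained from the Taylor polynomial of degree `n`. -/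
theorem abs_le_of_abs_le_on_dense_subset {f : ℝ → ℝ} {a b ρ M η m : ℝ} {E : Set ℝ} (hab : a < b)
    (hρ : 0 < ρ) (hM : 0 < M) (hη : 0 < η) (hη1 : η ≤ 1) (hlen : 24 * (b - a) ≤ ρ * η)
    (hf : ContDiffOn ℝ (⊤ : ℕ∞) f (Icc a b))
    (hbound : ∀ k : ℕ, ∀ x ∈ Icc a b,
      |iteratedDerivWithin k f (Icc a b) x| ≤ M * k.factorial / (2 * ρ) ^ k)
    (hE : E ⊆ Icc a b) (hvol : ENNReal.ofReal (η * (b - a)) ≤ volume E) (hm : 0 ≤ m)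
    (hfE : ∀ y ∈ E, |f y| ≤ m) {x : ℝ} (hx : x ∈ Icc a b) (n : ℕ) :
    |f x| ≤ 4 * (m * (12 / η) ^ n + M * (1 / 2) ^ n) := by
  set A := 12 / η with hAdef
  have hba : 0 < b - a := sub_pos.2 hab
  have hA : 1 ≤ A := by
    rw [hAdef, le_div_iff₀ hη]
    linarith
  have hA0 : 0 < A := by linarith
  have hlen' : 2 * A * (b - a) ≤ ρ := by
    rw [hAdef, show 2 * (12 / η) * (b - a) = 24 * (b - a) / η by ring, div_le_iff₀ hη]
    exact hlen
  set R := M * (1 / (2 * A)) ^ n with hR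
  have hR0 : 0 ≤ R := by positivity
  have htaylor : ∀ y ∈ Icc a b, |f y - taylorWithinEval f n (Icc a b) a y| ≤ R :=
    fun y hy => abs_sub_taylorWithinEval_le hab hρ hM hA hlen' hf hbound n hy
  set P : Polynomial ℝ := ∑ k ∈ Finset.range (n + 1),
    Polynomial.C ((k.factorial : ℝ)⁻¹ * iteratedDerivWithin k f (Icc a b) a)
      * (Polynomial.X - Polynomial.C a) ^ k with hPdef
  have hPeval : ∀ y, P.eval y = taylorWithinEval f n (Icc a b) a y := by
    intro y
    rw [taylor_within_apply, hPdef, Polynomial.eval_finsetSum]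
    refine Finset.sum_congr rfl fun k _ => ?_
    simp only [Polynomial.eval_mul, Polynomial.eval_C, Polynomial.eval_pow, Polynomial.eval_sub,
      Polynomial.eval_X, smul_eq_mul]
    ring
  have hPdeg : P.degree < (n + 1 : ℕ) := by
    refine (Polynomial.degree_sum_le _ _).trans_lt ?_
    rw [Finset.sup_lt_iff (WithBot.bot_lt_coe _)]
    intro k hk
    refine lt_of_le_of_lt (Polynomial.degree_mul_le _ _) ?_
    refine lt_of_le_of_lt (add_le_add_left Polynomial.degree_C_le _) ?_
    rw [zero_add, Polynomial.degree_pow, Polynomial.degree_X_sub_C, nsmul_eq_mul, mul_one]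
    exact_mod_cast Finset.mem_range.1 hk
  set h := η * (b - a) / (2 * (n + 1)) with hh
  have hh0 : 0 < h := by positivity
  obtain ⟨p, hpE, hp⟩ := exists_separated_seq hh0 (n + 1) E (bddBelow_Icc.mono hE) (by
    convert hvol using 2
    rw [hh]
    push_cast
    field_simp)
  have hPx := abs_eval_le_of_separated hPdeg hh0 hba.le (add_nonneg hm hR0) hp
    (fun i hi => by
      rw [hPeval]
      have h1 := hfE _ (hpE i hi)
      have h2 := htaylor _ (hE (hpE i hi))
      rw [abs_le] at h1 h2 ⊢
      constructor <;> linarith [h1.1, h1.2, h2.1, h2.2])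
    (t := x) (fun i hi => by
      have h1 := hE (hpE i hi)
      rw [abs_le]
      constructor <;> linarith [h1.1, h1.2, hx.1, hx.2])
  have hfactor : (2 * (b - a) / h) ^ n / n.factorial ≤ 3 * A ^ n := by
    have h1 : 2 * (b - a) / h = 4 / η * (n + 1) := by
      rw [hh]
      field_simp
      norm_num
    rw [h1, mul_pow, mul_div_assoc, hAdef, show (12 : ℝ) / η = 4 / η * 3 by ring, mul_pow,
      mul_left_comm]
    exact mul_le_mul_of_nonneg_left (add_one_pow_div_factorial_le n) (by positivity)
  have hPx' : |P.eval x| ≤ (m + R) * (3 * A ^ n) :=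
    hPx.trans (mul_le_mul_of_nonneg_left hfactor (add_nonneg hm hR0))
  have hfx : |f x| ≤ R + |P.eval x| := by
    have := htaylor x hx
    rw [← hPeval] at this
    have h2 := abs_add_le (f x - P.eval x) (P.eval x)
    rw [sub_add_cancel] at h2
    linarith
  have hRA : R * A ^ n = M * (1 / 2) ^ n := by
    rw [hR, mul_assoc, ← mul_pow]
    congr 2
    field_simp
  have hAn : 1 ≤ A ^ n := one_le_pow₀ hA
  have hRle : R ≤ R * A ^ n := le_mul_of_one_le_right hR0 hAn
  have hmA : 0 ≤ m * A ^ n := by positivity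
  rw [← hRA]
  linarith

/-- Propagation of a Hölder-type smallness estimate along a chain of cells, where `S j m` means
that the quantity of interest is at most `m` on cell `j`. -/
theorem exists_le_rpow_of_chain (γ₀ B : ℝ) (hγ₀ : γ₀ ∈ Ioo (0 : ℝ) 1) (hB : 0 < B) (d : ℕ) :
    ∃ N γ : ℝ, 0 < N ∧ γ ∈ Ioo (0 : ℝ) 1 ∧ ∀ (K : ℕ) (S : ℕ → ℝ → Prop),
      (∀ j m m', m ≤ m' → S j m → S j m') → (∀ j < K, S j 1) →
      (∀ i < K, ∀ j < K, (j = i + 1 ∨ i = j + 1) → ∀ m ∈ Icc (0 : ℝ) 1, S i m →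
        S j (B * m ^ γ₀)) →
      ∀ u ∈ Icc (0 : ℝ) 1, ∀ k < K, S k (B * u ^ γ₀) →
        ∀ j < K, j ≤ k + d → k ≤ j + d → S j (N * u ^ γ) := by
  induction d with
  | zero =>
    refine ⟨B, γ₀, hB, hγ₀, fun K S _ _ _ u _ k _ hk j _ h1 h2 => ?_⟩
    obtain rfl : j = k := by lia
    exact hk
  | succ d ih =>
    obtain ⟨N, γ, hN, hγ, H⟩ := ih
    have hγ' : γ * γ₀ ≤ γ := mul_le_of_le_one_right hγ.1.le hγ₀.2.le
    refine ⟨max N (B * N ^ γ₀), γ * γ₀, lt_max_of_lt_left hN,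
      ⟨mul_pos hγ.1 hγ₀.1, hγ'.trans_lt hγ.2⟩,
      fun K S hmono hone hstep u hu k hkK hk j hj h1 h2 => ?_⟩
    have hprev := H K S hmono hone hstep u hu k hkK hk
    have hup : 0 ≤ u ^ γ := Real.rpow_nonneg hu.1 _
    have hneighbor : ∀ i < K, (j = i + 1 ∨ i = j + 1) → i ≤ k + d → k ≤ i + d →
        S j (max N (B * N ^ γ₀) * u ^ (γ * γ₀)) := by
      intro i hi hij hi1 hi2
      have hmem : min (N * u ^ γ) 1 ∈ Icc (0 : ℝ) 1 :=
        ⟨le_min (by positivity) zero_le_one, min_le_right _ _⟩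
      have hSi : S i (min (N * u ^ γ) 1) := by
        rcases min_choice (N * u ^ γ) 1 with h | h <;> rw [h]
        · exact hprev i hi hi1 hi2
        · exact hone i hi
      refine hmono _ _ _ ?_ (hstep i hi j hj hij _ hmem hSi)
      calc B * min (N * u ^ γ) 1 ^ γ₀ ≤ B * (N * u ^ γ) ^ γ₀ :=
            mul_le_mul_of_nonneg_left
              (Real.rpow_le_rpow hmem.1 (min_le_left _ _) hγ₀.1.le) hB.le
        _ = B * N ^ γ₀ * u ^ (γ * γ₀) := by
            rw [Real.mul_rpow hN.le hup, ← Real.rpow_mul hu.1, mul_assoc]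
        _ ≤ _ := mul_le_mul_of_nonneg_right (le_max_right _ _) (Real.rpow_nonneg hu.1 _)
    by_cases hd1 : j ≤ k + d
    · by_cases hd2 : k ≤ j + d
      · refine hmono _ _ _ ?_ (hprev j hj hd1 hd2)
        exact mul_le_mul (le_max_left _ _)
          (Real.rpow_le_rpow_of_exponent_ge_of_imp hu.1 hu.2 hγ' (fun _ h => by
            exact absurd h hγ.1.ne')) hup (le_max_of_le_left hN.le)
      · exact hneighbor (j + 1) (by lia) (Or.inr rfl) (by lia) (by lia)
    · exact hneighbor (j - 1) (by lia) (Or.inl (by lia)) (by lia) (by lia)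

theorem exists_mem_Icc_div {K : ℕ} (hK : 0 < K) {x : ℝ} (hx : x ∈ Icc (0 : ℝ) 1) :
    ∃ k < K, x ∈ Icc ((k : ℝ) / K) ((k + 1 : ℝ) / K) := by
  have hK' : (0 : ℝ) < K := by exact_mod_cast hK
  rcases hx.2.eq_or_lt with rfl | hx1
  · refine ⟨K - 1, by lia, ?_⟩
    rw [Nat.cast_sub hK, mem_Icc, div_le_one hK', le_div_iff₀ hK']
    constructor <;> push_cast <;> linarith
  · have h0 : 0 ≤ x * K := mul_nonneg hx.1 hK'.le
    refine ⟨⌊x * K⌋₊, (Nat.floor_lt h0).2 (mul_lt_of_lt_one_left hK' hx1), ?_, ?_⟩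
    · exact (div_le_iff₀ hK').2 (Nat.floor_le h0)
    · exact (le_div_iff₀ hK').2 (Nat.lt_floor_add_one _).le

theorem exists_volume_inter_Icc_ge {E : Set ℝ} {c : ℝ} (hE : E ⊆ Icc 0 1) {K : ℕ} (hK : 0 < K)
    (hvol : volume E = ENNReal.ofReal c) :
    ∃ k < K, ENNReal.ofReal (c / K) ≤ volume (E ∩ Icc ((k : ℝ) / K) ((k + 1 : ℝ) / K)) := by
  by_contra! hcon
  have hK' : (0 : ℝ) < K := by exact_mod_cast hK
  have hcover : E ⊆ ⋃ k ∈ Finset.range K, E ∩ Icc ((k : ℝ) / K) ((k + 1 : ℝ) / K) := by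
    intro x hx
    obtain ⟨k, hk, hxk⟩ := exists_mem_Icc_div hK (hE hx)
    exact mem_biUnion (Finset.mem_range.2 hk) ⟨hx, hxk⟩
  have h1 := (measure_mono hcover).trans (measure_biUnion_finset_le (μ := volume) _ _)
  have h2 := ENNReal.sum_lt_sum_of_nonempty (s := Finset.range K)
    (Finset.nonempty_range_iff.2 hK.ne') (fun k hk => hcon k (Finset.mem_range.1 hk))
  have h3 := h1.trans_lt h2
  rw [Finset.sum_const, Finset.card_range, hvol, ← ENNReal.ofReal_nsmul, nsmul_eq_mul,
    mul_div_cancel₀ _ hK'.ne'] at h3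
  exact lt_irrefl _ h3

/-- **Lemma 2 of the paper.** If `f` is smooth on `[0,1]` with
`|f^{(k)}(x)| ≤ M k! (2ρ)^{-k}` and `E ⊆ [0,1]` has positive measure, then
`‖f‖_{L^∞([0,1])} ≤ N ‖f‖_{L^∞(E)}^γ M^{1-γ}`, with `N` and `γ` depending only
on `ρ` and `|E|`. -/
theorem null_control_stmt_4 (ρ c : ℝ) (hρ : 0 < ρ) (hc : 0 < c) :
    ∃ N γ : ℝ, 0 < N ∧ γ ∈ Set.Ioo (0 : ℝ) 1 ∧
      ∀ (M : ℝ) (f : ℝ → ℝ) (E : Set ℝ),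
        0 < M →
        ContDiffOn ℝ (⊤ : ℕ∞) f (Set.Icc (0 : ℝ) 1) →
        (∀ (k : ℕ), ∀ x ∈ Set.Icc (0 : ℝ) 1,
          |iteratedDerivWithin k f (Set.Icc (0 : ℝ) 1) x| ≤
            M * (Nat.factorial k) / (2 * ρ) ^ k) →
        MeasurableSet E →
        E ⊆ Set.Icc (0 : ℝ) 1 →
        volume E = ENNReal.ofReal c →
        ∀ x ∈ Set.Icc (0 : ℝ) 1,
          |f x| ≤ N * (⨆ y ∈ E, |f y|) ^ γ * M ^ (1 - γ) := by
  set η := min c (1 / 2) with hη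
  have hη0 : 0 < η := lt_min hc (by norm_num)
  have hηhalf : η ≤ 1 / 2 := min_le_right _ _
  have hη1 : η ≤ 1 := hηhalf.trans (by norm_num)
  obtain ⟨γ₀, hγ₀, hinterp⟩ := exists_le_rpow_of_forall_le_mul_pow_add (A := 12 / η) (by
    rw [le_div_iff₀ hη0]
    linarith)
  obtain ⟨K, hKlen⟩ := exists_nat_ge (48 / (ρ * η))
  have hK' : (0 : ℝ) < K := lt_of_lt_of_le (by positivity) hKlen
  have hK : 0 < K := by exact_mod_cast hK'
  have hKρ : 24 * (2 / K) ≤ ρ * η := by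
    rw [div_le_iff₀ (by positivity)] at hKlen
    rw [← mul_div_assoc, div_le_iff₀ hK']
    linarith
  obtain ⟨N, γ, hN, hγ, hchain⟩ := exists_le_rpow_of_chain γ₀ 12 hγ₀ (by norm_num) K
  refine ⟨N, γ, hN, hγ, fun M f E hM hf hbound _ hE hvol x hx => ?_⟩
  have hfM : ∀ y ∈ Icc (0 : ℝ) 1, |f y| ≤ M := by
    intro y hy
    simpa using hbound 0 y hy
  have hlocal : ∀ a b : ℝ, 0 ≤ a → a < b → b ≤ 1 → b - a ≤ 2 / K → ∀ F ⊆ Icc a b,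
      ENNReal.ofReal (η * (b - a)) ≤ volume F → ∀ u ∈ Icc (0 : ℝ) 1,
      (∀ y ∈ F, |f y| ≤ M * u) → ∀ y ∈ Icc a b, |f y| ≤ M * (12 * u ^ γ₀) := by
    intro a b ha hab hb hlen F hF hvolF u hu hfF y hy
    have hsub : Icc a b ⊆ Icc (0 : ℝ) 1 := Icc_subset_Icc ha hb
    have h1 := abs_le_of_abs_le_on_dense_subset hab hρ hM hη0 hη1
      ((mul_le_mul_of_nonneg_left hlen (by norm_num)).trans hKρ) (hf.mono hsub)
      (fun k z hz => by
        rw [iteratedDerivWithin_subset hsub (uniqueDiffOn_Icc hab) (uniqueDiffOn_Icc zero_lt_one)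
          (hf.of_le (by exact_mod_cast le_top)) hz]
        exact hbound k z (hsub hz))
      hF hvolF (mul_nonneg hM.le hu.1) hfF hy
    have h2 := hinterp u hu (|f y| / (4 * M)) (fun n => by
      rw [div_le_iff₀ (by positivity)]
      refine (h1 n).trans_eq ?_
      ring)
    rw [div_le_iff₀ (by positivity)] at h2
    linarith
  set m := ⨆ y ∈ E, |f y| with hmdef
  have hinner : ∀ y, ⨆ _ : y ∈ E, |f y| ≤ M := fun y =>
    Real.iSup_le (fun hy => hfM y (hE hy)) hM.le
  have hm0 : 0 ≤ m := Real.iSup_nonneg fun y => Real.iSup_nonneg fun _ => abs_nonneg _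
  have hmM : m ≤ M := Real.iSup_le hinner hM.le
  have hfE : ∀ y ∈ E, |f y| ≤ m := by
    intro y hy
    have h1 : ⨆ _ : y ∈ E, |f y| ≤ m :=
      le_ciSup (f := fun y => ⨆ _ : y ∈ E, |f y|) ⟨M, by rintro _ ⟨z, rfl⟩; exact hinner z⟩ y
    rwa [ciSup_pos hy] at h1
  have hu : m / M ∈ Icc (0 : ℝ) 1 := ⟨by positivity, (div_le_one hM).2 hmM⟩
  have hJ : ∀ k : ℕ, (k : ℝ) / K < (k + 1 : ℝ) / K := fun k => by gcongr; linarith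
  have hJlen : ∀ k : ℕ, (k + 1 : ℝ) / K - (k : ℝ) / K = 1 / K := fun k => by ring
  have hJ1 : ∀ k < K, (k + 1 : ℝ) / K ≤ 1 := fun k hk => by
    rw [div_le_one hK']
    exact_mod_cast hk
  obtain ⟨k, hk, hvolk⟩ := exists_volume_inter_Icc_ge hE hK hvol
  obtain ⟨j, hj, hxj⟩ := exists_mem_Icc_div hK hx
  have hstart : ∀ y ∈ Icc ((k : ℝ) / K) ((k + 1 : ℝ) / K),
      |f y| ≤ M * (12 * (m / M) ^ γ₀) := by
    refine hlocal _ _ (by positivity) (hJ k) (hJ1 k hk) ?_ (E ∩ _)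
      inter_subset_right ?_ _ hu ?_
    · rw [hJlen]
      gcongr
      norm_num
    · refine le_trans (ENNReal.ofReal_le_ofReal ?_) hvolk
      rw [hJlen, mul_one_div]
      gcongr
      exact min_le_left _ _
    · intro y hy
      rw [mul_div_cancel₀ _ hM.ne']
      exact hfE y hy.1
  have hpair : ∀ i : ℕ, i + 1 < K → ∀ F ⊆ Icc ((i : ℝ) / K) ((i + 2 : ℝ) / K),
      ENNReal.ofReal (1 / K) ≤ volume F → ∀ u ∈ Icc (0 : ℝ) 1, (∀ y ∈ F, |f y| ≤ M * u) →
      ∀ y ∈ Icc ((i : ℝ) / K) ((i + 2 : ℝ) / K), |f y| ≤ M * (12 * u ^ γ₀) := by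
    intro i hi F hF hvolF
    have hlen : (i + 2 : ℝ) / K - (i : ℝ) / K = 2 / K := by ring
    refine hlocal _ _ (by positivity) (by gcongr; linarith) ?_ hlen.le F hF ?_
    · rw [div_le_one hK']
      exact_mod_cast hi
    · refine le_trans (ENNReal.ofReal_le_ofReal ?_) hvolF
      rw [hlen, ← mul_div_assoc]
      gcongr
      linarith
  have hfinal := hchain K (fun i u => ∀ y ∈ Icc ((i : ℝ) / K) ((i + 1 : ℝ) / K), |f y| ≤ M * u)
    (fun i u u' huu' h y hy => (h y hy).trans (mul_le_mul_of_nonneg_left huu' hM.le))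
    (fun i hi y hy => by
      rw [mul_one]
      exact hfM y ⟨le_trans (by positivity) hy.1, hy.2.trans (hJ1 i hi)⟩)
    (by
      rintro i hi j hj hij u hu h y hy
      have hvolJ : ENNReal.ofReal (1 / K) ≤ volume (Icc ((i : ℝ) / K) ((i + 1 : ℝ) / K)) := by
        rw [Real.volume_Icc, hJlen]
      rcases hij with rfl | rfl
      · refine hpair i hj _ (Icc_subset_Icc le_rfl (by gcongr; norm_num)) hvolJ u hu h y ?_
        push_cast at hy
        refine ⟨le_trans (by gcongr; linarith) hy.1, hy.2.trans_eq (by ring)⟩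
      · refine hpair j hi _ (Icc_subset_Icc ?_ ?_) hvolJ u hu h y
          ⟨hy.1, hy.2.trans (by gcongr; norm_num)⟩
        · push_cast
          gcongr
          linarith
        · push_cast
          exact (by ring : ((j : ℝ) + 1 + 1) / K = (j + 2) / K).le)
    (m / M) hu k hk hstart j hj (by lia) (by lia) x hxj
  refine hfinal.trans_eq ?_
  rw [Real.div_rpow hm0 hM.le, Real.rpow_sub hM, Real.rpow_one]
  ring
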